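/- Let F_q be a finite field with q elements of characteristic p, let k ≥ 2 with p ∤ k(k+1), let F ∈ F_q[x] be monic of degree n, and let h, d be integers with 0 < h < d ≤ n/k and d ≥ (n+1)/(k+2). Let S_q(d) be the set of monic polynomials G of degree d such that G^k·A ∈ I_q(F,h) for some monic polynomial A. Then |S_q(d)| ≤ 2·q^{(n − (k−1)d)/3}. -/

import Mathlib

open Polynomial

open Finset in
/-- The cofactor of the Vandermonde product in the numerator of the second divided difference of
`t ↦ t⁻ᵏ` at the points `x, y, z`. -/
noncomputable def dividedDiffCofactor {R : Type*} [CommRing R] (k : ℕ) (x y z : R) : R :=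
  ∑ i ∈ range k, y ^ i * (x * z) ^ (k - 1 - i) * ∑ j ∈ range (i + 1), x ^ j * z ^ (i - j)

/-- Factorisation of the numerator of the second divided difference of `t ↦ t⁻ᵏ`. -/
theorem cyclic_sum_pow_mul_sub_eq {R : Type*} [CommRing R] (k : ℕ) (x y z : R) :
    y ^ k * z ^ k * (y - z) + z ^ k * x ^ k * (z - x) + x ^ k * y ^ k * (x - y) =
      (x - y) * (y - z) * (x - z) * dividedDiffCofactor k x y z := by
  have key : (x - z) * dividedDiffCofactor k x y z =
      x ^ k * ∑ i ∈ Finset.range k, y ^ i * z ^ (k - 1 - i) -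
        z ^ k * ∑ i ∈ Finset.range k, y ^ i * x ^ (k - 1 - i) := by
    rw [dividedDiffCofactor, Finset.mul_sum, Finset.mul_sum, Finset.mul_sum,
      ← Finset.sum_sub_distrib]
    refine Finset.sum_congr rfl fun i hi => ?_
    have hg := (Commute.all x z).geom_sum₂_mul (i + 1)
    simp only [Nat.add_sub_cancel] at hg
    obtain ⟨m, rfl⟩ := Nat.exists_eq_add_of_lt (Finset.mem_range.mp hi)
    have hm : i + m + 1 - 1 - i = m := by omega
    rw [hm]
    linear_combination y ^ i * (x * z) ^ m * hg
  have hyz := (Commute.all y z).geom_sum₂_mul k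
  have hyx := (Commute.all y x).geom_sum₂_mul k
  linear_combination (-(x - y) * (y - z)) * key - (x - y) * x ^ k * hyz -
    (y - z) * z ^ k * hyx

/-- A finite sum of monic polynomials of degree `m` has degree `m` as soon as the number of its
terms is nonzero in the ring. -/
theorem natDegree_sum_of_monic {R ι : Type*} [CommRing R] (s : Finset ι)
    (f : ι → R[X]) (m : ℕ) (hf : ∀ i ∈ s, (f i).Monic ∧ (f i).natDegree = m)
    (hs : (s.card : R) ≠ 0) : (∑ i ∈ s, f i).natDegree = m ∧ ∑ i ∈ s, f i ≠ 0 := by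
  have hc : (∑ i ∈ s, f i).coeff m = s.card := by
    rw [finsetSum_coeff, Finset.sum_congr rfl (g := fun _ => (1 : R))]
    · simp
    · intro i hi
      rw [← (hf i hi).2]
      exact (hf i hi).1
  refine ⟨le_antisymm (natDegree_sum_le_of_forall_le _ _ fun i hi => (hf i hi).2.le) ?_, ?_⟩
  · exact le_natDegree_of_ne_zero (by rwa [hc])
  · intro h
    rw [h, coeff_zero] at hc
    exact hs hc.symm

theorem natDegree_geom_sum₂_of_monic {K : Type*} [Field K] {k d : ℕ} {x y : K[X]}
    (hx : x.Monic) (hy : y.Monic) (hxd : x.natDegree = d) (hyd : y.natDegree = d)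
    (hk : (k : K) ≠ 0) :
    (∑ i ∈ Finset.range k, x ^ i * y ^ (k - 1 - i)).natDegree = (k - 1) * d ∧
      ∑ i ∈ Finset.range k, x ^ i * y ^ (k - 1 - i) ≠ 0 := by
  refine natDegree_sum_of_monic _ _ _ (fun i hi => ⟨(hx.pow i).mul (hy.pow _), ?_⟩) (by simpa)
  rw [(hx.pow i).natDegree_mul (hy.pow _), hx.natDegree_pow, hy.natDegree_pow, hxd, hyd,
    ← add_mul]
  congr 1
  have := Finset.mem_range.mp hi
  omega

theorem natDegree_dividedDiffCofactor {K : Type*} [Field K] {k d : ℕ} {x y z : K[X]}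
    (hx : x.Monic) (hy : y.Monic) (hz : z.Monic)
    (hxd : x.natDegree = d) (hyd : y.natDegree = d) (hzd : z.natDegree = d)
    (hk : ((k * (k + 1) : ℕ) : K) ≠ 0) :
    (dividedDiffCofactor k x y z).natDegree = (2 * k - 2) * d ∧
      dividedDiffCofactor k x y z ≠ 0 := by
  simp only [dividedDiffCofactor, Finset.mul_sum]
  rw [Finset.sum_sigma']
  have hxz := hx.mul hz
  refine natDegree_sum_of_monic _ _ _ (fun i hi => ?_) ?_
  · have h1 : (x ^ i.2 * z ^ (i.1 - i.2)).Monic := (hx.pow _).mul (hz.pow _)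
    have h2 : (y ^ i.1 * (x * z) ^ (k - 1 - i.1)).Monic := (hy.pow _).mul (hxz.pow _)
    refine ⟨h2.mul h1, ?_⟩
    rw [h2.natDegree_mul h1, (hy.pow _).natDegree_mul (hxz.pow _),
      (hx.pow _).natDegree_mul (hz.pow _), hxz.natDegree_pow, hx.natDegree_pow,
      hy.natDegree_pow, hz.natDegree_pow, hx.natDegree_mul hz, hxd, hyd, hzd]
    simp only [Finset.mem_sigma, Finset.mem_range] at hi
    have hexp : 2 * k - 2 = i.1 + 2 * (k - 1 - i.1) + (i.2 + (i.1 - i.2)) := by omega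
    rw [hexp]
    ring
  · intro h0
    apply hk
    have hcard : ∀ m : ℕ, (∑ i ∈ Finset.range m, (i + 1)) * 2 = m * (m + 1) := by
      intro m
      induction m with
      | zero => simp
      | succ m ih => rw [Finset.sum_range_succ, add_mul, ih]; ring
    rw [← hcard k, Nat.cast_mul]
    simp only [Finset.card_sigma, Finset.card_range] at h0
    rw [h0, zero_mul]

/-- Two monic polynomials of degree `d` whose `k`-th powers divide elements of the same short
interval are not too close. -/
theorem le_add_natDegree_sub_of_pow_mul_close {K : Type*} [Field K] {k n h d : ℕ} (hk : 2 ≤ k)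
    (hk0 : (k : K) ≠ 0) {F : K[X]} (hF : F.Monic) (hFn : F.natDegree = n) (hhd : h < d)
    (hdn : k * d ≤ n) {G₁ G₂ A₁ A₂ : K[X]} (h₁ : G₁.Monic) (h₂ : G₂.Monic)
    (hd₁ : G₁.natDegree = d) (hd₂ : G₂.natDegree = d)
    (hA₁ : (F - G₁ ^ k * A₁).natDegree ≤ h) (hA₂ : (F - G₂ ^ k * A₂).natDegree ≤ h)
    (hne : G₁ ≠ G₂) : (k + 1) * d ≤ n + (G₁ - G₂).natDegree := by
  by_contra! hlt
  obtain ⟨hS, hS0⟩ := natDegree_geom_sum₂_of_monic h₁ h₂ hd₁ hd₂ hk0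
  have hg := (Commute.all G₁ G₂).geom_sum₂_mul k
  set S := ∑ i ∈ Finset.range k, G₁ ^ i * G₂ ^ (k - 1 - i)
  set E₁ := F - G₁ ^ k * A₁ with hE₁
  set E₂ := F - G₂ ^ k * A₂ with hE₂
  have hid : G₁ ^ k * G₂ ^ k * (A₁ - A₂) =
      -(F * (S * (G₁ - G₂))) - (E₁ * G₂ ^ k - E₂ * G₁ ^ k) := by
    rw [hE₁, hE₂]
    linear_combination F * hg
  have hM : (F * (S * (G₁ - G₂))).natDegree = n + ((k - 1) * d + (G₁ - G₂).natDegree) := by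
    rw [natDegree_mul hF.ne_zero (mul_ne_zero hS0 (sub_ne_zero.mpr hne)),
      natDegree_mul hS0 (sub_ne_zero.mpr hne), hS, hFn]
  have hE : (E₁ * G₂ ^ k - E₂ * G₁ ^ k).natDegree ≤ h + k * d := by
    refine (natDegree_sub_le _ _).trans (max_le ?_ ?_) <;> refine natDegree_mul_le.trans ?_
    · rw [h₂.natDegree_pow, hd₂]; omega
    · rw [h₁.natDegree_pow, hd₁]; omega
  obtain ⟨m, rfl⟩ := Nat.exists_eq_add_of_le hk
  have hm : 2 + m - 1 = m + 1 := by omega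
  rw [hm] at hM
  by_cases hA : A₁ - A₂ = 0
  · rw [hA, mul_zero] at hid
    have heq : F * (S * (G₁ - G₂)) = -(E₁ * G₂ ^ (2 + m) - E₂ * G₁ ^ (2 + m)) := by
      linear_combination hid
    rw [heq, natDegree_neg] at hM
    rw [hM] at hE
    nlinarith
  · have hdeg := congrArg natDegree hid
    rw [((h₁.pow (2 + m)).mul (h₂.pow (2 + m))).natDegree_mul' hA,
      (h₁.pow _).natDegree_mul (h₂.pow _), h₁.natDegree_pow, h₂.natDegree_pow, hd₁, hd₂] at hdeg
    have hle := natDegree_sub_le (-(F * (S * (G₁ - G₂)))) (E₁ * G₂ ^ (2 + m) - E₂ * G₁ ^ (2 + m))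
    rw [← hdeg, natDegree_neg, hM] at hle
    rcases le_max_iff.mp hle with h | h <;> nlinarith

/-- Three monic polynomials of degree `d` whose `k`-th powers divide elements of the same short
interval are not too close. -/
theorem le_add_natDegree_sub_triple_of_pow_mul_close {K : Type*} [Field K] {k n h d : ℕ}
    (hk : 2 ≤ k) (hk0 : ((k * (k + 1) : ℕ) : K) ≠ 0) {F : K[X]} (hF : F.Monic)
    (hFn : F.natDegree = n) (hhd : h < d) (hdn : k * d ≤ n) {x y z A B C : K[X]}
    (hx : x.Monic) (hy : y.Monic) (hz : z.Monic)
    (hxd : x.natDegree = d) (hyd : y.natDegree = d) (hzd : z.natDegree = d)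
    (hA : (F - x ^ k * A).natDegree ≤ h) (hB : (F - y ^ k * B).natDegree ≤ h)
    (hC : (F - z ^ k * C).natDegree ≤ h) (hxy : x ≠ y) (hyz : y ≠ z) (hxz : x ≠ z)
    {t : ℕ} (htd : t < d) (hxyt : (x - y).natDegree ≤ t) (hyzt : (y - z).natDegree ≤ t)
    (hxzt : (x - z).natDegree ≤ t) : (k + 2) * d ≤ n + 3 * t := by
  have hkK : (k : K) ≠ 0 := fun h0 => hk0 (by rw [Nat.cast_mul, h0, zero_mul])
  have h₁ := le_add_natDegree_sub_of_pow_mul_close hk hkK hF hFn hhd hdn hx hy hxd hyd hA hB hxy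
  have h₂ := le_add_natDegree_sub_of_pow_mul_close hk hkK hF hFn hhd hdn hy hz hyd hzd hB hC hyz
  have h₃ := le_add_natDegree_sub_of_pow_mul_close hk hkK hF hFn hhd hdn hx hz hxd hzd hA hC hxz
  by_contra! hlt
  obtain ⟨hQ, hQ0⟩ := natDegree_dividedDiffCofactor hx hy hz hxd hyd hzd hk0
  have hg := cyclic_sum_pow_mul_sub_eq k x y z
  have hxy0 := sub_ne_zero.mpr hxy
  have hyz0 := sub_ne_zero.mpr hyz
  have hxz0 := sub_ne_zero.mpr hxz
  set Q := dividedDiffCofactor k x y z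
  set E₁ := F - x ^ k * A with hE₁
  set E₂ := F - y ^ k * B with hE₂
  set E₃ := F - z ^ k * C with hE₃
  set M := F * ((x - y) * (y - z) * (x - z) * Q) with hMdef
  set E := E₁ * (y ^ k * z ^ k) * (y - z) - E₂ * (z ^ k * x ^ k) * (x - z)
    + E₃ * (x ^ k * y ^ k) * (x - y) with hEdef
  have hid : x ^ k * y ^ k * z ^ k * (A * (y - z) - B * (x - z) + C * (x - y)) = M - E := by
    rw [hMdef, hEdef, hE₁, hE₂, hE₃]
    linear_combination F * hg
  have hM : M.natDegree = n + ((x - y).natDegree + (y - z).natDegree + (x - z).natDegree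
      + (2 * k - 2) * d) := by
    rw [hMdef, natDegree_mul hF.ne_zero (by simp [*]), natDegree_mul (by simp [*]) hQ0,
      natDegree_mul (by simp [*]) hxz0, natDegree_mul hxy0 hyz0, hQ, hFn]
  have hterm : ∀ {e u v w : K[X]}, e.natDegree ≤ h → u.Monic → v.Monic → u.natDegree = d →
      v.natDegree = d →
      (e * (u ^ k * v ^ k) * w).natDegree ≤ h + 2 * (k * d) + w.natDegree := by
    intro e u v w he hu hv hud hvd
    refine natDegree_mul_le.trans (Nat.add_le_add_right (natDegree_mul_le.trans ?_) _)
    rw [(hu.pow k).natDegree_mul (hv.pow k), hu.natDegree_pow, hv.natDegree_pow, hud, hvd]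
    omega
  have hE : E.natDegree ≤ h + 2 * (k * d) +
      max (max (y - z).natDegree (x - z).natDegree) (x - y).natDegree := by
    refine (natDegree_add_le _ _).trans (max_le ?_ ?_)
    · refine (natDegree_sub_le _ _).trans (max_le ?_ ?_)
      · exact (hterm hA hy hz hyd hzd).trans (by omega)
      · exact (hterm hB hz hx hzd hxd).trans (by omega)
    · exact (hterm hC hx hy hxd hyd).trans (by omega)
  obtain ⟨m, rfl⟩ := Nat.exists_eq_add_of_le hk
  have hm : 2 * (2 + m) - 2 = 2 * m + 2 := by omega
  rw [hm] at hM
  by_cases hP : A * (y - z) - B * (x - z) + C * (x - y) = 0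
  · rw [hP, mul_zero] at hid
    rw [sub_eq_zero.mp hid.symm] at hM
    rw [hM] at hE
    ring_nf at *
    omega
  · have hdeg := congrArg natDegree hid
    have hxym := (hx.pow (2 + m)).mul (hy.pow (2 + m))
    rw [(hxym.mul (hz.pow (2 + m))).natDegree_mul' hP, hxym.natDegree_mul (hz.pow _),
      (hx.pow _).natDegree_mul (hy.pow _), hx.natDegree_pow, hy.natDegree_pow,
      hz.natDegree_pow, hxd, hyd, hzd] at hdeg
    have hle := natDegree_sub_le M E
    rw [← hdeg, hM] at hle
    ring_nf at *
    omega

/-- **Bound (5.13).** Let `k ≥ 2` with `p ∤ k(k+1)`. If `0 < h < d ≤ n/k` and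
`d ≥ (n+1)/(k+2)`, then `|S_q(d)| ≤ 2·q^{(n − (k−1)d)/3}`. -/
theorem card_Sqd_triple_bound
    {Fq : Type} [Field Fq] [Fintype Fq] (q p k n h d : ℕ) [CharP Fq p]
    (hq : Fintype.card Fq = q) (hk : 2 ≤ k) (hp : ¬ p ∣ k * (k + 1))
    (F : Polynomial Fq) (hF : F.Monic) (hFdeg : F.natDegree = n)
    (hh0 : 0 < h) (hhd : h < d) (hdn : (d : ℝ) ≤ (n : ℝ) / k)
    (hd2 : ((n : ℝ) + 1) / ((k : ℝ) + 2) ≤ (d : ℝ)) :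
    ({G : Polynomial Fq | G.Monic ∧ G.natDegree = d ∧
        ∃ A : Polynomial Fq, A.Monic ∧
          (F - G ^ k * A).degree ≤ (h : WithBot ℕ)}.ncard : ℝ)
      ≤ 2 * (q : ℝ) ^ (((n : ℝ) - ((k : ℝ) - 1) * d) / 3) := by
  classical
  set S := {G : Polynomial Fq | G.Monic ∧ G.natDegree = d ∧
        ∃ A : Polynomial Fq, A.Monic ∧ (F - G ^ k * A).degree ≤ (h : WithBot ℕ)}
  have hkpos : (0 : ℝ) < k := by exact_mod_cast (by omega : 0 < k)
  have hdn' : k * d ≤ n := by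
    rw [le_div_iff₀ hkpos] at hdn
    have : d * k ≤ n := by exact_mod_cast hdn
    linarith
  have hd2' : n + 1 ≤ (k + 2) * d := by
    rw [div_le_iff₀ (by positivity)] at hd2
    have : n + 1 ≤ d * (k + 2) := by exact_mod_cast hd2
    linarith
  have hk0 : ((k * (k + 1) : ℕ) : Fq) ≠ 0 := fun h0 => hp ((CharP.cast_eq_zero_iff Fq p _).mp h0)
  have hq1 : (1 : ℝ) ≤ q := by
    rw [← hq]
    exact_mod_cast Fintype.card_pos
  rcases S.finite_or_infinite with hfin | hinf
  swap
  · rw [hinf.ncard, Nat.cast_zero]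
    positivity
  obtain ⟨t, ht1, ht2, htd⟩ : ∃ t, n + 3 * t < (k + 2) * d ∧ (k + 2) * d ≤ n + 3 * (t + 1) ∧
      t < d := by
    have : (k + 2) * d = k * d + 2 * d := by ring
    exact ⟨((k + 2) * d - n - 1) / 3, by omega, by omega, by omega⟩
  let topCoeffs : Fq[X] → (Fin (d - (t + 1)) → Fq) := fun G i => G.coeff (t + 1 + i)
  have hclose : ∀ G₁ ∈ S, ∀ G₂ ∈ S, topCoeffs G₁ = topCoeffs G₂ → (G₁ - G₂).natDegree ≤ t := by
    rintro G₁ ⟨hm₁, hd₁, -⟩ G₂ ⟨hm₂, hd₂, -⟩ heq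
    rw [natDegree_le_iff_coeff_eq_zero]
    intro N hN
    rw [coeff_sub, sub_eq_zero]
    rcases lt_trichotomy N d with hlt | rfl | hgt
    · have := congrFun heq ⟨N - (t + 1), by omega⟩
      simpa [topCoeffs, Nat.add_sub_cancel' (Nat.succ_le_of_lt hN)] using this
    · have h₁ := hm₁.coeff_natDegree
      have h₂ := hm₂.coeff_natDegree
      rw [hd₁] at h₁
      rw [hd₂] at h₂
      rw [h₁, h₂]
    · rw [coeff_eq_zero_of_natDegree_lt (by omega), coeff_eq_zero_of_natDegree_lt (by omega)]
  have hcard : hfin.toFinset.card ≤ 2 * q ^ (d - (t + 1)) := by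
    have hfib := Finset.card_le_mul_card_image_of_maps_to (s := hfin.toFinset)
      (t := Finset.univ) (f := topCoeffs) (fun _ _ => Finset.mem_univ _) 2 ?_
    · simpa [hq] using hfib
    · intro c _
      by_contra! hgt
      obtain ⟨x, hx, y, hy, z, hz, hxy, hxz, hyz⟩ := Finset.two_lt_card.mp hgt
      simp only [Finset.mem_filter, Set.Finite.mem_toFinset] at hx hy hz
      have hxy' := hclose x hx.1 y hy.1 (hx.2.trans hy.2.symm)
      have hyz' := hclose y hy.1 z hz.1 (hy.2.trans hz.2.symm)
      have hxz' := hclose x hx.1 z hz.1 (hx.2.trans hz.2.symm)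
      obtain ⟨⟨hxm, hxd, A, -, hA⟩, -⟩ := hx
      obtain ⟨⟨hym, hyd, B, -, hB⟩, -⟩ := hy
      obtain ⟨⟨hzm, hzd, C, -, hC⟩, -⟩ := hz
      have := le_add_natDegree_sub_triple_of_pow_mul_close hk hk0 hF hFdeg hhd hdn' hxm hym hzm
        hxd hyd hzd (natDegree_le_of_degree_le hA) (natDegree_le_of_degree_le hB)
        (natDegree_le_of_degree_le hC) hxy hyz hxz htd hxy' hyz' hxz'
      omega
  rw [Set.ncard_eq_toFinset_card S hfin]
  calc (hfin.toFinset.card : ℝ) ≤ 2 * (q : ℝ) ^ (d - (t + 1)) := by exact_mod_cast hcard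
    _ ≤ 2 * (q : ℝ) ^ (((n : ℝ) - ((k : ℝ) - 1) * d) / 3) := by
      rw [← Real.rpow_natCast]
      refine mul_le_mul_of_nonneg_left (Real.rpow_le_rpow_of_exponent_le hq1 ?_) zero_le_two
      rw [Nat.cast_sub htd, le_div_iff₀ (by norm_num)]
      have : ((k : ℝ) + 2) * d ≤ n + 3 * (t + 1) := by exact_mod_cast ht2
      push_cast
      linarith
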